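/- With A, A^s and S as above (rad²(A) = 0), a module M ∈ Mod A is projective if and only if S(M) is projective in Mod A^s. -/

import Mathlib

/-- The Jacobson radical `J = rad A` of a ring, as a module over `A`. -/
abbrev JacMod (A : Type) [Ring A] : Type := ↥(Ideal.jacobson (⊥ : Ideal A))

/-- The separated algebra `A^s = (A/J, 0; J, A/J)` of a radical square zero artin algebra,
realized as the trivial square-zero extension of `(A/J) × (A/J)` by the bimodule `J`
(the left action through the second factor, the right action through the first factor,
corresponding to lower-triangular 2×2 matrix multiplication). -/
abbrev SepAlg (A : Type) [Ring A] (S : Type) [Ring S]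
    [Module (S × S) (JacMod A)] [Module (S × S)ᵐᵒᵖ (JacMod A)]
    [SMulCommClass (S × S) (S × S)ᵐᵒᵖ (JacMod A)] : Type :=
  TrivSqZeroExt (S × S) (JacMod A)

/-- The submodule `JM ⊆ M` generated by the elements `j • m`, `j ∈ J = rad A`. -/
noncomputable def radSubmodule (A : Type) [Ring A] (M : Type) [AddCommGroup M]
    [Module A M] : Submodule A M :=
  Submodule.span A {x : M | ∃ j ∈ Ideal.jacobson (⊥ : Ideal A), ∃ m : M, j • m = x}

/-- The underlying abelian group of the separated module `S(M) = (M/JM; JM)`. -/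
abbrev SepMod (A : Type) [Ring A] (M : Type) [AddCommGroup M] [Module A M] : Type :=
  (M ⧸ radSubmodule A M) × ↥(radSubmodule A M)


lemma act_eq
    (A : Type) [Ring A]
    (hJ2 : ∀ x ∈ Ideal.jacobson (⊥ : Ideal A), ∀ y ∈ Ideal.jacobson (⊥ : Ideal A),
      x * y = 0)
    (S : Type) [Ring S] (π : A →+* S) (hπ : Function.Surjective π)
    (hker : ∀ a : A, π a = 0 ↔ a ∈ Ideal.jacobson (⊥ : Ideal A))
    [Module (S × S) (JacMod A)] [Module (S × S)ᵐᵒᵖ (JacMod A)]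
    [SMulCommClass (S × S) (S × S)ᵐᵒᵖ (JacMod A)]
    (hL : ∀ (x y : A) (m : JacMod A),
      ((((π x, π y) : S × S) • m : JacMod A) : A) = y * (m : A))
    (hR : ∀ (x y : A) (m : JacMod A),
      (((MulOpposite.op ((π x, π y) : S × S)) • m : JacMod A) : A) = (m : A) * x)
    (M : Type) [AddCommGroup M] [Module A M]
    [Module (SepAlg A S) (SepMod A M)]
    (hM1 : ∀ (x y : A) (p : SepMod A M),
      (TrivSqZeroExt.inl ((π x, π y) : S × S) : SepAlg A S) • p = (x • p.1, y • p.2))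
    (hM2 : ∀ (j : JacMod A) (m : M) (u : ↥(radSubmodule A M)),
      ((TrivSqZeroExt.inr j : SepAlg A S) •
          ((Submodule.Quotient.mk m, u) : SepMod A M)).1 = 0 ∧
      ((((TrivSqZeroExt.inr j : SepAlg A S) •
          ((Submodule.Quotient.mk m, u) : SepMod A M)).2 : M)) = (j : A) • m)
    (b : SepAlg A S) (x y : A) (hb : b.fst = (π x, π y)) (m : M)
    (u : ↥(radSubmodule A M)) :
    (b • ((Submodule.Quotient.mk m, u) : SepMod A M)).1 =
      Submodule.Quotient.mk (x • m) ∧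
    ((b • ((Submodule.Quotient.mk m, u) : SepMod A M)).2 : M) =
      y • (u : M) + (b.snd : A) • m := by
  have h : b = TrivSqZeroExt.inl (π x, π y) + TrivSqZeroExt.inr b.snd := by
    rw [← hb, TrivSqZeroExt.inl_fst_add_inr_snd_eq]
  have h2 := hM2 b.snd m u
  have h1 := hM1 x y (Submodule.Quotient.mk m, u)
  generalize hj : b.snd = j at *
  subst h
  rw [add_smul, h1]
  constructor
  · rw [Prod.fst_add, h2.1, add_zero]; rfl
  · rw [Prod.snd_add, Submodule.coe_add, h2.2]; rfl

lemma rad_coord (A : Type) [Ring A] (S : Type) [Ring S] (π : A →+* S)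
    (hker : ∀ a : A, π a = 0 ↔ a ∈ Ideal.jacobson (⊥ : Ideal A))
    (M : Type) [AddCommGroup M] [Module A M] {N : Type}
    (s : M →ₗ[A] (N →₀ A)) (u : M) (hu : u ∈ radSubmodule A M) (i : N) :
    s u i ∈ Ideal.jacobson (⊥ : Ideal A) := by
  rw [← hker]
  induction hu using Submodule.span_induction with
  | mem x h =>
    obtain ⟨j, hj, m, rfl⟩ := h
    simp [(hker j).2 hj]
  | zero => simp
  | add x y _ _ hx hy => simp [hx, hy]
  | smul a x _ hx => simp [hx]

lemma forward_dir
    (A : Type) [Ring A]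
    (hJ2 : ∀ x ∈ Ideal.jacobson (⊥ : Ideal A), ∀ y ∈ Ideal.jacobson (⊥ : Ideal A),
      x * y = 0)
    (S : Type) [Ring S] (π : A →+* S) (hπ : Function.Surjective π)
    (hker : ∀ a : A, π a = 0 ↔ a ∈ Ideal.jacobson (⊥ : Ideal A))
    [Module (S × S) (JacMod A)] [Module (S × S)ᵐᵒᵖ (JacMod A)]
    [SMulCommClass (S × S) (S × S)ᵐᵒᵖ (JacMod A)]
    (hL : ∀ (x y : A) (m : JacMod A),
      ((((π x, π y) : S × S) • m : JacMod A) : A) = y * (m : A))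
    (hR : ∀ (x y : A) (m : JacMod A),
      (((MulOpposite.op ((π x, π y) : S × S)) • m : JacMod A) : A) = (m : A) * x)
    (M : Type) [AddCommGroup M] [Module A M]
    [Module (SepAlg A S) (SepMod A M)]
    (hM1 : ∀ (x y : A) (p : SepMod A M),
      (TrivSqZeroExt.inl ((π x, π y) : S × S) : SepAlg A S) • p = (x • p.1, y • p.2))
    (hM2 : ∀ (j : JacMod A) (m : M) (u : ↥(radSubmodule A M)),
      ((TrivSqZeroExt.inr j : SepAlg A S) •
          ((Submodule.Quotient.mk m, u) : SepMod A M)).1 = 0 ∧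
      ((((TrivSqZeroExt.inr j : SepAlg A S) •
          ((Submodule.Quotient.mk m, u) : SepMod A M)).2 : M)) = (j : A) • m)
    (hp : Module.Projective A M) : Module.Projective (SepAlg A S) (SepMod A M) := by
  classical
  have act := act_eq A hJ2 S π hπ hker hL hR M hM1 hM2
  obtain ⟨s, hs⟩ := Module.projective_def'.1 hp
  have hrad := rad_coord A S π hker M s
  have hout : ∀ m : M, ∀ i, π (s (Quotient.out (Submodule.Quotient.mk m : M ⧸ radSubmodule A M)) i)
      = π (s m i) := by
    intro m i
    have h : Quotient.out (Submodule.Quotient.mk m : M ⧸ radSubmodule A M) - m ∈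
        radSubmodule A M := by
      rw [← Submodule.Quotient.eq]
      exact Quotient.out_eq _
    have := (hker _).2 (hrad _ h i)
    rwa [map_sub, Finsupp.sub_apply, map_sub, sub_eq_zero] at this
  let c : SepMod A M → M → SepAlg A S := fun p i =>
    TrivSqZeroExt.inl (π (s (Quotient.out p.1) i), 0) +
      TrivSqZeroExt.inr ⟨s p.2 i, hrad _ p.2.2 i⟩
  have hc1 : ∀ (m : M) u i, (c (Submodule.Quotient.mk m, u) i).fst = (π (s m i), 0) := by
    intro m u i
    simp [c, hout]
  have hc2 : ∀ (m : M) u i, ((c (Submodule.Quotient.mk m, u) i).snd : A) = s (u : M) i := by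
    intro m u i
    simp [c]
  have hc0 : ∀ p i, c p i ≠ 0 → i ∈ (s (Quotient.out p.1)).support ∪ (s (p.2 : M)).support := by
    intro p i h
    by_contra h'
    simp only [Finset.mem_union, Finsupp.mem_support_iff, not_or, not_not] at h'
    apply h
    ext <;> simp [c, h'.1, h'.2]
  have hind : ∀ p : SepMod A M, ∃ m u, p = (Submodule.Quotient.mk m, u) := by
    rintro ⟨p, u⟩
    obtain ⟨m, rfl⟩ := Submodule.Quotient.mk_surjective _ p
    exact ⟨m, u, rfl⟩
  let σ : SepMod A M →ₗ[SepAlg A S] (M →₀ SepAlg A S) :=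
    { toFun := fun p => Finsupp.onFinset _ (c p) (hc0 p)
      map_add' := by
        intro p q
        obtain ⟨m, u, rfl⟩ := hind p
        obtain ⟨n, v, rfl⟩ := hind q
        refine Finsupp.ext fun i => ?_
        rw [Finsupp.add_apply]
        simp only [Finsupp.onFinset_apply]
        rw [Prod.mk_add_mk, ← Submodule.Quotient.mk_add]
        refine TrivSqZeroExt.ext ?_ (Subtype.ext ?_)
        · rw [hc1]; erw [TrivSqZeroExt.fst_add]; rw [hc1, hc1]; simp
        · rw [hc2]; erw [TrivSqZeroExt.snd_add]; rw [Submodule.coe_add, Submodule.coe_add, hc2, hc2]; simp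
      map_smul' := by
        intro b p
        obtain ⟨m, u, rfl⟩ := hind p
        obtain ⟨x, hx⟩ := hπ b.fst.1
        obtain ⟨y, hy⟩ := hπ b.fst.2
        have hb : b.fst = (π x, π y) := by rw [hx, hy]
        have ha := act b x y hb m u
        obtain ⟨n, v, hnv⟩ := hind (b • ((Submodule.Quotient.mk m, u) : SepMod A M))
        have e1 : b • ((Submodule.Quotient.mk m, u) : SepMod A M) =
          (Submodule.Quotient.mk (x • m), v) := by
          refine Prod.ext ha.1 ?_
          rw [hnv]
        have e2 : (v : M) = y • (u : M) + (b.snd : A) • m := by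
          rw [← ha.2, hnv]
        refine Finsupp.ext fun i => ?_
        rw [e1]
        simp only [Finsupp.onFinset_apply, RingHom.id_apply, Finsupp.smul_apply, smul_eq_mul]
        refine TrivSqZeroExt.ext ?_ (Subtype.ext ?_)
        · rw [TrivSqZeroExt.fst_mul, hc1, hc1, hb]; simp
        · rw [TrivSqZeroExt.snd_mul, Submodule.coe_add, hc1, hc2, hb, hL, hc2, e2,
            ← map_zero π, hR]
          simp }
  let v : M → SepMod A M := fun m => (Submodule.Quotient.mk m, 0)
  refine Module.Projective.of_split σ (Finsupp.linearCombination (SepAlg A S) v) ?_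
  ext1 p
  obtain ⟨m, u, rfl⟩ := hind p
  have key : ∀ i, c (Submodule.Quotient.mk m, u) i • v i =
      ((Submodule.Quotient.mk (s m i • i), ⟨s (u : M) i • i,
        Submodule.subset_span ⟨_, hrad _ u.2 i, _, rfl⟩⟩) : SepMod A M) := by
    intro i
    have := act (c (Submodule.Quotient.mk m, u) i) (s m i) 0 (by rw [hc1, map_zero]) i 0
    refine Prod.ext this.1 (Subtype.ext ?_)
    rw [this.2, hc2]; simp
  have hs' : ∀ (m : M) (t : Finset M), (s m).support ⊆ t → ∑ i ∈ t, s m i • i = m := by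
    intro m t ht
    have := LinearMap.congr_fun hs m
    rw [LinearMap.comp_apply, Finsupp.linearCombination_apply,
      Finsupp.sum_of_support_subset _ ht _ (by simp)] at this
    simpa using this
  let t := (s (Quotient.out (Submodule.Quotient.mk m : M ⧸ radSubmodule A M))).support ∪
    (s (u : M)).support ∪ (s m).support
  have h1 : (σ (Submodule.Quotient.mk m, u)).support ⊆ t := by
    refine Finset.Subset.trans (Finsupp.support_onFinset_subset (hf := hc0 _)) ?_
    exact Finset.subset_union_left
  rw [LinearMap.comp_apply, Finsupp.linearCombination_apply,
    Finsupp.sum_of_support_subset _ h1 _ (by simp)]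
  have h2 : ∑ i ∈ t, (σ (Submodule.Quotient.mk m, u)) i • v i =
     ∑ i ∈ t, ((Submodule.Quotient.mk (s m i • i), ⟨s (u : M) i • i,
        Submodule.subset_span ⟨_, hrad _ u.2 i, _, rfl⟩⟩) : SepMod A M) :=
    Finset.sum_congr rfl fun i _ => key i
  rw [h2, LinearMap.id_apply]
  refine Prod.ext ?_ (Subtype.ext ?_)
  · rw [Prod.fst_sum]
    have := congrArg (Submodule.mkQ (radSubmodule A M)) (hs' m t Finset.subset_union_right)
    rw [map_sum] at this
    exact this
  · rw [Prod.snd_sum, Submodule.coe_sum]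
    exact hs' u t (Finset.subset_union_right.trans Finset.subset_union_left)

lemma idem_lift (E : Type) [Ring E] (g : E) (h : (g * g - g) * (g * g - g) = 0) :
    ∃ e c : E, e * e = e ∧ e - g = (g * g - g) * (1 - 2 * g) ∧ e = c * g := by
  open Polynomial in
  have h1 : (3 * X * X - 2 * X * X * X : ℤ[X]) * (3 * X * X - 2 * X * X * X)
      - (3 * X * X - 2 * X * X * X) =
      ((X * X - X) * (X * X - X)) * (4 * X * X - 4 * X - 3) := by ring
  have h2 := congrArg (Polynomial.aeval g) h1
  simp only [map_sub, map_mul, Polynomial.aeval_X, map_ofNat] at h2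
  open Polynomial in
  have h3 : (3 * X * X - 2 * X * X * X : ℤ[X]) - X = (X * X - X) * (1 - 2 * X) := by ring
  have h4 := congrArg (Polynomial.aeval g) h3
  simp only [map_sub, map_mul, Polynomial.aeval_X, map_ofNat, map_one] at h4
  refine ⟨3 * g * g - 2 * g * g * g, 3 * g - 2 * g * g, ?_, h4, ?_⟩
  · rwa [h, zero_mul, sub_eq_zero] at h2
  · rw [sub_mul]

lemma backward_dir
    (A : Type) [Ring A]
    (hJ2 : ∀ x ∈ Ideal.jacobson (⊥ : Ideal A), ∀ y ∈ Ideal.jacobson (⊥ : Ideal A),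
      x * y = 0)
    (S : Type) [Ring S] (π : A →+* S) (hπ : Function.Surjective π)
    (hker : ∀ a : A, π a = 0 ↔ a ∈ Ideal.jacobson (⊥ : Ideal A))
    [Module (S × S) (JacMod A)] [Module (S × S)ᵐᵒᵖ (JacMod A)]
    [SMulCommClass (S × S) (S × S)ᵐᵒᵖ (JacMod A)]
    (hL : ∀ (x y : A) (m : JacMod A),
      ((((π x, π y) : S × S) • m : JacMod A) : A) = y * (m : A))
    (hR : ∀ (x y : A) (m : JacMod A),
      (((MulOpposite.op ((π x, π y) : S × S)) • m : JacMod A) : A) = (m : A) * x)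
    (M : Type) [AddCommGroup M] [Module A M]
    [Module (SepAlg A S) (SepMod A M)]
    (hM1 : ∀ (x y : A) (p : SepMod A M),
      (TrivSqZeroExt.inl ((π x, π y) : S × S) : SepAlg A S) • p = (x • p.1, y • p.2))
    (hM2 : ∀ (j : JacMod A) (m : M) (u : ↥(radSubmodule A M)),
      ((TrivSqZeroExt.inr j : SepAlg A S) •
          ((Submodule.Quotient.mk m, u) : SepMod A M)).1 = 0 ∧
      ((((TrivSqZeroExt.inr j : SepAlg A S) •
          ((Submodule.Quotient.mk m, u) : SepMod A M)).2 : M)) = (j : A) • m)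
    (hp : Module.Projective (SepAlg A S) (SepMod A M)) : Module.Projective A M := by
  classical
  have act := act_eq A hJ2 S π hπ hker hL hR M hM1 hM2
  let v : M → SepMod A M := fun m => (Submodule.Quotient.mk m, 0)
  let L := Finsupp.linearCombination (SepAlg A S) v
  have hvL : ∀ m, v m ∈ LinearMap.range L := fun m => ⟨Finsupp.single m 1, by simp [L]⟩
  have hLsurj : Function.Surjective L := by
    have h0 : ∀ u, ∀ hu : u ∈ radSubmodule A M, ((0, ⟨u, hu⟩) : SepMod A M) ∈
        LinearMap.range L := by
      intro u hu
      induction hu using Submodule.span_induction with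
      | mem x h =>
        obtain ⟨j, hj, m, rfl⟩ := h
        have h2 := hM2 ⟨j, hj⟩ m 0
        convert (LinearMap.range L).smul_mem (TrivSqZeroExt.inr ⟨j, hj⟩) (hvL m) using 1
        exact Prod.ext h2.1.symm (Subtype.ext h2.2.symm)
      | zero => exact zero_mem _
      | add x y h1 h2 hx hy =>
        convert add_mem hx hy using 1
        exact Prod.ext (by simp) rfl
      | smul a x h hx =>
        convert (LinearMap.range L).smul_mem (TrivSqZeroExt.inl (π a, π a)) hx using 1
        rw [hM1]
        exact Prod.ext (by simp) rfl
    rintro ⟨p, u⟩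
    obtain ⟨m, rfl⟩ := Submodule.Quotient.mk_surjective _ p
    have : ((Submodule.Quotient.mk m, u) : SepMod A M) ∈ LinearMap.range L := by
      convert add_mem (hvL m) (h0 u u.2) using 1
      simp [v]
    exact this
  obtain ⟨t, ht⟩ := Module.projective_lifting_property L LinearMap.id hLsurj
  let T : M → M → S := fun m i => (t (v m) i).fst.1
  have hv_add : ∀ m n, v (m + n) = v m + v n := fun m n => by simp [v]
  have hv_smul : ∀ (a : A) m, v (a • m) =
      (TrivSqZeroExt.inl (π a, π 0) : SepAlg A S) • v m := fun a m => by
    rw [hM1]; simp [v]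
  have hTadd : ∀ m n i, T (m + n) i = T m i + T n i := by
    intro m n i
    simp [T, hv_add]
  have hTsmul : ∀ a m i, T (a • m) i = π a * T m i := by
    intro a m i
    simp only [T, hv_smul, map_smul, Finsupp.smul_apply, smul_eq_mul, TrivSqZeroExt.fst_mul,
      TrivSqZeroExt.fst_inl, Prod.fst_mul]
  have hT0 : ∀ u ∈ radSubmodule A M, ∀ i, T u i = 0 := by
    intro u hu i
    have : v u = 0 := Prod.ext ((Submodule.Quotient.mk_eq_zero _).2 hu) rfl
    simp [T, this]
  have hTeq : ∀ m n, m - n ∈ radSubmodule A M → ∀ i, T m i = T n i := by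
    intro m n h i
    have := hTadd (m - n) n i
    rwa [sub_add_cancel, hT0 _ h, zero_add] at this
  have ht1 : ∀ m i, t (v m) i = TrivSqZeroExt.inl (T m i, 0) := by
    intro m i
    have h : v m = (TrivSqZeroExt.inl (π 1, π 0) : SepAlg A S) • v m := by
      rw [← hv_smul, one_smul]
    have h2 : t (v m) i = (TrivSqZeroExt.inl (π 1, π 0) : SepAlg A S) * t (v m) i := by
      conv_lhs => rw [h, map_smul]
      rfl
    rw [h2]
    refine TrivSqZeroExt.ext ?_ (Subtype.ext ?_)
    · rw [TrivSqZeroExt.fst_mul]; simp [T, Prod.ext_iff]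
    · rw [TrivSqZeroExt.snd_mul, TrivSqZeroExt.snd_inl, smul_zero, add_zero,
        TrivSqZeroExt.fst_inl, hL]
      simp
  -- lift to `A`
  have hG : ∀ m, ∃ G : M →₀ A, ∀ i, π (G i) = T m i := by
    intro m
    obtain ⟨r, hr⟩ := hπ.hasRightInverse
    refine ⟨Finsupp.onFinset (t (v m)).support (fun i => if T m i = 0 then 0 else r (T m i)) ?_, ?_⟩
    · intro i hi
      rw [Finsupp.mem_support_iff]
      intro h
      apply hi
      simp [T, h]
    · intro i
      rw [Finsupp.onFinset_apply]
      split_ifs with h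
      · rw [h, map_zero]
      · exact hr _
  choose G hG using hG
  let p : (M →₀ A) →ₗ[A] M := Finsupp.linearCombination A id
  let g : (M →₀ A) →ₗ[A] (M →₀ A) := Finsupp.linearCombination A G
  have hgT : ∀ x i, π (g x i) = T (p x) i := by
    intro x i
    induction x using Finsupp.induction_linear with
    | zero => simp [hT0 0 (zero_mem _)]
    | add x y hx hy => rw [map_add, map_add, hTadd, Finsupp.add_apply, map_add, hx, hy]
    | single m a => simp [g, p, hG, hTsmul]
  have hpG : ∀ m, p (G m) - m ∈ radSubmodule A M := by
    intro m
    have h := LinearMap.congr_fun ht (v m)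
    let w := (t (v m)).support ∪ (G m).support
    rw [LinearMap.comp_apply, LinearMap.id_apply, Finsupp.linearCombination_apply,
      Finsupp.sum_of_support_subset (s := w) _ Finset.subset_union_left _ (by simp)] at h
    have h1 := congrArg Prod.fst h
    rw [Prod.fst_sum] at h1
    rw [← Submodule.Quotient.eq]
    refine Eq.trans ?_ h1
    have h2 : p (G m) = ∑ i ∈ w, G m i • i := by
      rw [Finsupp.linearCombination_apply,
        Finsupp.sum_of_support_subset (s := w) _ Finset.subset_union_right _ (by simp)]
      rfl
    rw [h2, ← Submodule.mkQ_apply, map_sum]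
    refine Finset.sum_congr rfl fun i _ => ?_
    rw [ht1, ← hG, ← map_zero π, hM1]
    rfl
  have hpg : ∀ x, p (g x) - p x ∈ radSubmodule A M := by
    intro x
    induction x using Finsupp.induction_linear with
    | zero => simp
    | add x y hx hy =>
      convert add_mem hx hy using 1
      simp only [map_add]; abel
    | single m a =>
      convert (radSubmodule A M).smul_mem a (hpG m) using 1
      simp [g, p, smul_sub]
  have key : ∀ y : M →₀ A, (∀ i, π (y i) = 0) → p y = 0 → g y = 0 := by
    intro y hy hpy
    let Y : M → JacMod A := fun i => ⟨y i, (hker _).1 (hy i)⟩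
    have h1 : ∑ i ∈ y.support, (TrivSqZeroExt.inr (Y i) : SepAlg A S) • v i = 0 := by
      refine Prod.ext ?_ (Subtype.ext ?_)
      · rw [Prod.fst_sum]
        exact Finset.sum_eq_zero fun i _ => (hM2 (Y i) i 0).1
      · rw [Prod.snd_sum, Submodule.coe_sum]
        rw [Finset.sum_congr rfl fun i _ => (hM2 (Y i) i 0).2]
        exact hpy
    have h2 := congrArg t h1
    rw [map_sum, map_zero] at h2
    refine Finsupp.ext fun k => ?_
    have h3 := congrArg (fun z : M →₀ SepAlg A S => ((z k).snd : A)) h2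
    simp only [map_smul, Finsupp.finsetSum_apply, Finsupp.smul_apply, smul_eq_mul, ht1,
      TrivSqZeroExt.snd_sum, Submodule.coe_sum, Finsupp.zero_apply, TrivSqZeroExt.snd_zero,
      Submodule.coe_zero] at h3
    rw [Finsupp.zero_apply, ← h3, Finsupp.linearCombination_apply, Finsupp.sum,
      Finsupp.finsetSum_apply]
    refine Finset.sum_congr rfl fun i _ => ?_
    rw [TrivSqZeroExt.snd_mul, ← hG, ← map_zero π, TrivSqZeroExt.fst_inl, Submodule.coe_add, hR]
    simp [Y]
  -- idempotent lifting
  let d : Module.End A (M →₀ A) := g * g - g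
  have hd : ∀ x i, π (d x i) = 0 := by
    intro x i
    have : d x i = g (g x) i - g x i := rfl
    rw [this, map_sub, hgT, hgT, sub_eq_zero]
    exact hTeq _ _ (hpg x) i
  have hdd : d * d = 0 := by
    have h0 : ∀ x : M →₀ A, (∀ i, π (x i) = 0) → d x = 0 := by
      intro x hx
      have hx' : d x = x.sum fun i a => a • d (Finsupp.single i 1) := by
        conv_lhs => rw [← Finsupp.sum_single x]
        rw [map_finsuppSum]
        refine Finsupp.sum_congr fun i _ => ?_
        rw [← map_smul, Finsupp.smul_single, smul_eq_mul, mul_one]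
      rw [hx']
      refine Finset.sum_eq_zero fun i _ => ?_
      refine Finsupp.ext fun k => ?_
      exact hJ2 _ ((hker _).1 (hx i)) _ ((hker _).1 (hd _ k))
    refine LinearMap.ext fun x => h0 _ (hd x)
  let g' : Module.End A (M →₀ A) := g
  obtain ⟨e, c, hee, heg, heg2⟩ := idem_lift (Module.End A (M →₀ A)) g' hdd
  have he_e : ∀ x, e (e x) = e x := fun x => LinearMap.congr_fun hee x
  have heT : ∀ x i, π (e x i) = T (p x) i := by
    intro x i
    rw [← hgT]
    have h1 : e x - g x = d ((1 - 2 * g') x) := LinearMap.congr_fun heg x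
    have h2 := hd ((1 - 2 * g') x) i
    rwa [← h1, Finsupp.sub_apply, map_sub, sub_eq_zero] at h2
  have hpe : ∀ x, p (e x) - p x ∈ radSubmodule A M := by
    intro x
    have h1 : e x - g x = d ((1 - 2 * g') x) := LinearMap.congr_fun heg x
    have h2 : ∀ y, p (d y) ∈ radSubmodule A M := by
      intro y
      have := hpg (g y)
      have h3 : d y = g (g y) - g y := rfl
      rw [h3, map_sub]
      exact this
    have h3 := add_mem (h2 ((1 - 2 * g') x)) (hpg x)
    rw [← h1, map_sub] at h3
    convert h3 using 1
    abel
  let q : (M →₀ A) →ₗ[A] M := p ∘ₗ e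
  have hpsurj : ∀ m, p (Finsupp.single m 1) = m := by intro m; simp [p]
  have hjrad : ∀ j ∈ Ideal.jacobson (⊥ : Ideal A), ∀ u ∈ radSubmodule A M, j • u = 0 := by
    intro j hj u hu
    induction hu using Submodule.span_induction generalizing j with
    | mem x h =>
      obtain ⟨k, hk, m, rfl⟩ := h
      rw [smul_smul, hJ2 j hj k hk, zero_smul]
    | zero => simp
    | add x y _ _ hx hy => rw [smul_add, hx j hj, hy j hj, add_zero]
    | smul a x _ hx =>
      rw [smul_smul]
      exact hx _ ((hker _).1 (by rw [map_mul, (hker j).2 hj, zero_mul]))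
  have hradq : radSubmodule A M ≤ LinearMap.range q := by
    refine Submodule.span_le.2 ?_
    rintro _ ⟨j, hj, m, rfl⟩
    refine ⟨j • Finsupp.single m 1, ?_⟩
    have h1 := hjrad j hj _ (hpe (Finsupp.single m 1))
    rw [hpsurj, smul_sub, sub_eq_zero] at h1
    rw [map_smul]
    exact h1
  have hq : Function.Surjective q := by
    intro m
    have h1 := hradq (hpe (Finsupp.single m 1))
    rw [hpsurj] at h1
    have h2 : q (Finsupp.single m 1) ∈ LinearMap.range q := ⟨_, rfl⟩
    have h3 := sub_mem h2 h1
    have h4 : q (Finsupp.single m 1) = p (e (Finsupp.single m 1)) := rfl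
    rw [h4, sub_sub_cancel] at h3
    exact h3
  have hkerq : LinearMap.ker q ≤ LinearMap.ker e := by
    intro x hx
    have hx' : p (e x) = 0 := hx
    have h1 : ∀ i, π (e x i) = 0 := by
      intro i
      rw [← he_e, heT, hx']
      exact hT0 _ (zero_mem _) i
    have h2 := key _ h1 hx'
    have h3 : e (e x) = c (g (e x)) := LinearMap.congr_fun heg2 (e x)
    rw [h2, map_zero, he_e] at h3
    exact h3
  let r : M →ₗ[A] (M →₀ A) :=
    (LinearMap.ker q).liftQ e hkerq ∘ₗ (q.quotKerEquivOfSurjective hq).symm.toLinearMap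
  have hr : ∀ x, r (q x) = e x := by
    intro x
    have : (q.quotKerEquivOfSurjective hq).symm (q x) = Submodule.Quotient.mk x := by
      rw [LinearEquiv.symm_apply_eq]; rfl
    simp only [r, LinearMap.comp_apply, LinearEquiv.coe_coe, this]
    rfl
  refine Module.Projective.of_split r q ?_
  refine LinearMap.ext fun m => ?_
  obtain ⟨x, rfl⟩ := hq m
  rw [LinearMap.comp_apply, hr]
  change p (e (e x)) = p (e x)
  rw [he_e]

/-- With `A`, `A^s` and `S` as above (`rad²(A) = 0`), a module
`M ∈ Mod A` is projective if and only if `S(M) = (M/JM; JM)` is projective in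
`Mod A^s`. -/
theorem separated_functor_reflects_projectivity
    (R : Type) [CommRing R] [IsArtinianRing R]
    (A : Type) [Ring A] [Algebra R A] [Module.Finite R A]
    (hJ2 : ∀ x ∈ Ideal.jacobson (⊥ : Ideal A), ∀ y ∈ Ideal.jacobson (⊥ : Ideal A),
      x * y = 0)
    (S : Type) [Ring S] (π : A →+* S) (hπ : Function.Surjective π)
    (hker : ∀ a : A, π a = 0 ↔ a ∈ Ideal.jacobson (⊥ : Ideal A))
    [Module (S × S) (JacMod A)] [Module (S × S)ᵐᵒᵖ (JacMod A)]
    [SMulCommClass (S × S) (S × S)ᵐᵒᵖ (JacMod A)]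
    (hL : ∀ (x y : A) (m : JacMod A),
      ((((π x, π y) : S × S) • m : JacMod A) : A) = y * (m : A))
    (hR : ∀ (x y : A) (m : JacMod A),
      (((MulOpposite.op ((π x, π y) : S × S)) • m : JacMod A) : A) = (m : A) * x)
    (M : Type) [AddCommGroup M] [Module A M]
    [Module (SepAlg A S) (SepMod A M)]
    (hM1 : ∀ (x y : A) (p : SepMod A M),
      (TrivSqZeroExt.inl ((π x, π y) : S × S) : SepAlg A S) • p = (x • p.1, y • p.2))
    (hM2 : ∀ (j : JacMod A) (m : M) (u : ↥(radSubmodule A M)),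
      ((TrivSqZeroExt.inr j : SepAlg A S) •
          ((Submodule.Quotient.mk m, u) : SepMod A M)).1 = 0 ∧
      ((((TrivSqZeroExt.inr j : SepAlg A S) •
          ((Submodule.Quotient.mk m, u) : SepMod A M)).2 : M)) = (j : A) • m) :
    Module.Projective A M ↔ Module.Projective (SepAlg A S) (SepMod A M) := by
  exact ⟨forward_dir A hJ2 S π hπ hker hL hR M hM1 hM2,
    backward_dir A hJ2 S π hπ hker hL hR M hM1 hM2⟩
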